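/- If a homeomorphism f of a metric space X has the large periods property and X has an isolated point x (i.e., the singleton {x} is open in X), then X = {x}; in particular X is a singleton. -/

import Mathlib

open Metric Filter

/-- The orbit `{f^k p : k ∈ ℤ}` of a point `p` under a homeomorphism `f`. -/
def orbitZ {X : Type*} [TopologicalSpace X] (f : X ≃ₜ X) (p : X) : Set X :=
  {x | ∃ k : ℤ, (f.toEquiv ^ k) p = x}

/-- A set `S` is `ε`-dense in `X` if every point of `X` lies within distance `ε`
of some point of `S`. -/
def epsDense {X : Type*} [MetricSpace X] (S : Set X) (ε : ℝ) : Prop :=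
  ∀ x : X, ∃ y ∈ S, dist x y ≤ ε

/-- A homeomorphism `f` has the large periods property. -/
def LargePeriods {X : Type*} [MetricSpace X] (f : X ≃ₜ X) : Prop :=
  ∀ ε > (0 : ℝ), ∃ N₀ : ℕ, ∀ n ≥ N₀, ∃ p : X,
    (⇑f)^[n] p = p ∧ epsDense (orbitZ f p) ε

/-- Every point of an orbit inherits the periods of the base point. -/
theorem iterate_eq_self_of_mem_orbitZ {X : Type*} [TopologicalSpace X] (f : X ≃ₜ X)
    {p x : X} {n : ℕ} (hp : (⇑f)^[n] p = p) (hx : x ∈ orbitZ f p) : (⇑f)^[n] x = x := by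
  obtain ⟨k, rfl⟩ := hx
  have hpow (z : X) : (⇑f)^[n] z = (f.toEquiv ^ n) z := by
    rw [Equiv.Perm.coe_pow]
    rfl
  rw [hpow] at hp ⊢
  rw [← Equiv.Perm.mul_apply, ((Commute.refl f.toEquiv).pow_left n |>.zpow_right k).eq,
    Equiv.Perm.mul_apply, hp]

/-- An orbit containing a fixed point contains no other point. -/
theorem eq_of_mem_orbitZ_of_fixed {X : Type*} [TopologicalSpace X] (f : X ≃ₜ X)
    {p x y : X} (hfx : f x = x) (hx : x ∈ orbitZ f p) (hy : y ∈ orbitZ f p) : y = x := by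
  obtain ⟨k, hk⟩ := hx
  obtain ⟨m, rfl⟩ := hy
  have hz (j : ℤ) : (f.toEquiv ^ j) x = x := Equiv.Perm.zpow_apply_eq_self_of_apply_eq_self hfx j
  have hpx : p = x := (f.toEquiv ^ k).injective (hk.trans (hz k).symm)
  rw [hpx, hz m]

/-- If a homeomorphism of a metric space has the large periods property and the
space has an isolated point `x`, then the space is the singleton `{x}`. -/
theorem largePeriods_isolated_point_singleton {X : Type*} [MetricSpace X]
    (f : X ≃ₜ X) (h : LargePeriods f) (x : X) (hx : IsOpen ({x} : Set X)) :
    ∀ y : X, y = x := by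
  intro y
  obtain ⟨r, hr, hball⟩ := Metric.isOpen_iff.mp hx x rfl
  by_contra hne
  have hd : 0 < dist y x := dist_pos.mpr hne
  obtain ⟨N, hN⟩ := h (min (r / 2) (dist y x / 2)) (by positivity)
  have mem_of_dense {p : X} (hp : epsDense (orbitZ f p) (min (r / 2) (dist y x / 2))) :
      x ∈ orbitZ f p := by
    obtain ⟨z, hz, hxz⟩ := hp x
    have hzx : z = x := hball <| by
      rw [mem_ball, dist_comm]
      linarith [hxz.trans (min_le_left _ _)]
    exact hzx ▸ hz
  obtain ⟨p, hp, hpd⟩ := hN N le_rfl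
  obtain ⟨q, hq, hqd⟩ := hN (N + 1) N.le_succ
  have hfx : f x = x := by
    have hsucc := iterate_eq_self_of_mem_orbitZ f hq (mem_of_dense hqd)
    rwa [Function.iterate_succ_apply',
      iterate_eq_self_of_mem_orbitZ f hp (mem_of_dense hpd)] at hsucc
  obtain ⟨z, hz, hyz⟩ := hpd y
  rw [eq_of_mem_orbitZ_of_fixed f hfx (mem_of_dense hpd) hz] at hyz
  linarith [hyz.trans (min_le_right _ _)]
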